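/- arXiv:1811.02685 — 3 statements merged into one kernel-verified Lean document; each statement's English description precedes it below -/
import Mathlib

section
/- Let (X,d) be a metric space, let ρ_1,…,ρ_m be pseudometrics on X with weights p_1,…,p_m ≥ 0 summing to 1, and let K, L ≥ 1 be reals. Fix points u, u', v ∈ X and suppose: (i) Σ_j p_j · ρ_j(u,u') ≥ d(u,u')/K; (ii) ρ_j(u',v) ≤ L · d(u',v) for every j; and (iii) d(u',v) ≤ d(u,v)/(4KL). Then Σ_j p_j · ρ_j(u,v) ≥ d(u,v)/(2K). -/
/-- A pseudometric on `X`: nonnegative, vanishing on the diagonal, symmetric,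
satisfying the triangle inequality. -/
def IsPseudometric {X : Type*} (ρ : X → X → ℝ) : Prop :=
  (∀ x y, 0 ≤ ρ x y) ∧ (∀ x, ρ x x = 0) ∧ (∀ x y, ρ x y = ρ y x) ∧
  (∀ x y z, ρ x z ≤ ρ x y + ρ y z)

/-- The expectation chain from the second case of the proof of the Multi-face
embedding theorem: if the nearest point `u'` of the distinguished face to `v`
is close to `v` relative to `d(u,v)`, then the expected distance between the
images of `u` and `v` is at least `d(u,v)/(2K)`. -/
theorem expected_distance_lower_bound_close_case
    {X : Type*} [MetricSpace X]
    (m : ℕ) (ρ : Fin m → X → X → ℝ) (p : Fin m → ℝ)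
    (hρ : ∀ j, IsPseudometric (ρ j))
    (hp : ∀ j, 0 ≤ p j) (hpsum : ∑ j, p j = 1)
    (K L : ℝ) (hK : 1 ≤ K) (hL : 1 ≤ L)
    (u u' v : X)
    (h₁ : dist u u' / K ≤ ∑ j, p j * ρ j u u')
    (h₂ : ∀ j, ρ j u' v ≤ L * dist u' v)
    (h₃ : dist u' v ≤ dist u v / (4 * K * L)) :
    dist u v / (2 * K) ≤ ∑ j, p j * ρ j u v := by
  have hK0 : 0 < K := by linarith
  have hsum : ∑ j, p j * ρ j u u' ≤ ∑ j, p j * ρ j u v + L * dist u' v := by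
    calc ∑ j, p j * ρ j u u' ≤ ∑ j, (p j * ρ j u v + p j * (L * dist u' v)) := by
          refine Finset.sum_le_sum fun j _ => ?_
          obtain ⟨-, -, hsymm, htri⟩ := hρ j
          rw [← mul_add]
          refine mul_le_mul_of_nonneg_left ?_ (hp j)
          linarith [htri u v u', hsymm v u', h₂ j]
      _ = ∑ j, p j * ρ j u v + L * dist u' v := by
          rw [Finset.sum_add_distrib, ← Finset.sum_mul, hpsum, one_mul]
  have hL_le : L * dist u' v ≤ dist u v / K / 4 := by
    rw [le_div_iff₀ (by positivity)] at h₃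
    rw [div_div, le_div_iff₀ (by positivity)]
    linarith
  have hdiv_le : dist u' v / K ≤ L * dist u' v :=
    (div_le_self dist_nonneg hK).trans (le_mul_of_one_le_left dist_nonneg hL)
  have htri : dist u v / K ≤ dist u u' / K + dist u' v / K := by
    rw [← add_div]
    exact div_le_div_of_nonneg_right (dist_triangle u u' v) hK0.le
  have hhalf : dist u v / (2 * K) = dist u v / K / 2 := by
    rw [div_div, mul_comm]
  linarith
end

section
/- Let (X,d) be a finite metric space, let A ⊆ X be nonempty, and let K, L ≥ 1 be reals. Let ρ_1,…,ρ_m be pseudometrics on X with weights p_1,…,p_m ≥ 0 summing to 1, such that: (i) ρ_j(x,y) ≤ L · d(x,y) for every j and all x,y ∈ X; and (ii) Σ_j p_j · ρ_j(u,u') ≥ d(u,u')/K for all u,u' ∈ A. Then for every u ∈ A and every v ∈ X, max( d(v,A), Σ_j p_j · ρ_j(u,v) ) ≥ d(u,v)/(4KL), where d(v,A) = min_{a ∈ A} d(v,a). -/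
/-- The per-face dichotomy underlying the Multi-face embedding theorem: for a
terminal `u` on a distinguished face `A`, either the distance-to-`A` coordinate
already separates `u` from `v` by at least `d(u,v)/(4KL)`, or the random face
embedding does so in expectation. -/
theorem face_dichotomy
    {X : Type*} [MetricSpace X] [Fintype X]
    (A : Set X) (hA : A.Nonempty)
    (K L : ℝ) (hK : 1 ≤ K) (hL : 1 ≤ L)
    (m : ℕ) (ρ : Fin m → X → X → ℝ) (p : Fin m → ℝ)
    (hρ : ∀ j, IsPseudometric (ρ j))
    (hp : ∀ j, 0 ≤ p j) (hpsum : ∑ j, p j = 1)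
    (hLip : ∀ j, ∀ x y : X, ρ j x y ≤ L * dist x y)
    (hlow : ∀ u ∈ A, ∀ u' ∈ A, dist u u' / K ≤ ∑ j, p j * ρ j u u') :
    ∀ u ∈ A, ∀ v : X,
      dist u v / (4 * K * L) ≤
        max (Metric.infDist v A) (∑ j, p j * ρ j u v) := by
  intro u hu v
  obtain ⟨a, ha, hva⟩ := A.toFinite.isCompact.exists_infDist_eq_dist hA v
  rw [hva]
  set t := dist u v / (4 * K * L) with ht
  have hD : dist u v = 4 * K * L * t := by
    rw [ht]
    field_simp
  have ht0 : 0 ≤ t := by positivity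
  rcases le_or_gt t (dist v a) with h | h
  · exact le_max_of_le_left h
  refine le_max_of_le_right ?_
  have hsum : ∑ j, p j * ρ j u a ≤ ∑ j, p j * ρ j u v + L * dist v a :=
    calc ∑ j, p j * ρ j u a ≤ ∑ j, (p j * ρ j u v + p j * (L * dist v a)) := by
          refine Finset.sum_le_sum fun j _ => ?_
          rw [← mul_add]
          exact mul_le_mul_of_nonneg_left
            (((hρ j).2.2.2 u v a).trans (by gcongr; exact hLip j v a)) (hp j)
      _ = ∑ j, p j * ρ j u v + L * dist v a := by
          rw [Finset.sum_add_distrib, ← Finset.sum_mul, hpsum, one_mul]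
  have hua : 3 * L * t ≤ dist u a / K := by
    rw [le_div_iff₀ (by positivity)]
    have hKL : 1 ≤ K * L := one_le_mul_of_one_le_of_one_le hK hL
    rw [dist_comm v a] at h
    have := dist_triangle u a v
    nlinarith [mul_le_mul_of_nonneg_right hKL ht0]
  have hLt : L * dist v a ≤ L * t := by gcongr
  nlinarith [hlow u hu a ha, mul_le_mul_of_nonneg_right hL ht0]
end

section
/- Let (X,d) be a finite metric space, let γ ≥ 1 be an integer, let A_1,…,A_γ be nonempty subsets of X, and let K, L ≥ 1 be reals. For each i ∈ {1,…,γ}, let (ρ_{i,j}, p_{i,j})_{j=1,…,m_i} be a finitely supported stochastic family of pseudometrics on X such that: (i) ρ_{i,j}(x,y) ≤ L · d(x,y) for every j and all x,y ∈ X; and (ii) Σ_j p_{i,j} · ρ_{i,j}(u,u') ≥ d(u,u')/K for all u,u' ∈ A_i. For each i define the pseudometric τ_i on X by τ_i(x,y) = | d(x,A_i) − d(y,A_i) |, where d(x,A) = min_{a ∈ A} d(x,a). Consider the combined stochastic family that assigns weight p_{i,j}/(2γ) to each ρ_{i,j} and weight 1/(2γ) to each τ_i. Then: (a) the combined weights are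 nonnegative and sum to 1; (b) every member of the combined family is bounded above by L · d pointwise; and (c) for every u ∈ A_1 ∪ ⋯ ∪ A_γ and every v ∈ X, the expectation of the combined family at (u,v) is at least d(u,v)/(8γKL). -/
/-- The distance-to-a-set coordinate is `1`-Lipschitz. -/
lemma abs_infDist_sub_infDist_le_dist {X : Type*} [PseudoMetricSpace X] (s : Set X) (x y : X) :
    |Metric.infDist x s - Metric.infDist y s| ≤ dist x y := by
  simpa [Real.dist_eq] using (Metric.lipschitz_infDist_pt s).dist_le_mul x y

/-- If a stochastic family of `L`-Lipschitz pseudometrics contracts pairs of points of a finite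
set `s` in expectation by at most a factor `K`, then adding the distance to `s` to its expectation
bounds the distance from any point of `s` to an arbitrary point, up to a factor `2KL`. -/
lemma dist_div_le_expectation_add_infDist {X ι : Type*} [PseudoMetricSpace X] [Fintype ι]
    {s : Set X} (hs : s.Finite) {K L : ℝ} (hK : 1 ≤ K) (hL : 1 ≤ L)
    {ρ : ι → X → X → ℝ} {p : ι → ℝ} (hρ : ∀ j, IsPseudometric (ρ j))
    (hp : ∀ j, 0 ≤ p j) (hpsum : ∑ j, p j = 1)
    (hLip : ∀ j x y, ρ j x y ≤ L * dist x y)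
    (hlow : ∀ u ∈ s, ∀ u' ∈ s, dist u u' / K ≤ ∑ j, p j * ρ j u u')
    {u : X} (hu : u ∈ s) (v : X) :
    dist u v / (2 * K * L) ≤ ∑ j, p j * ρ j u v + Metric.infDist v s := by
  obtain ⟨w, hw, hvw⟩ := hs.isCompact.exists_infDist_eq_dist ⟨u, hu⟩ v
  rw [hvw]
  have hE : 0 ≤ ∑ j, p j * ρ j u v :=
    Finset.sum_nonneg fun j _ => mul_nonneg (hp j) ((hρ j).1 u v)
  have hsum : ∑ j, p j * ρ j u w ≤ ∑ j, p j * ρ j u v + L * dist v w := by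
    calc ∑ j, p j * ρ j u w ≤ ∑ j, (p j * ρ j u v + p j * (L * dist v w)) := by
          refine Finset.sum_le_sum fun j _ => ?_
          rw [← mul_add]
          exact mul_le_mul_of_nonneg_left
            (((hρ j).2.2.2 u v w).trans (by linarith [hLip j v w])) (hp j)
      _ = _ := by rw [Finset.sum_add_distrib, ← Finset.sum_mul, hpsum, one_mul]
  have hlow' := (hlow u hu w hw).trans hsum
  have htri : dist u v ≤ dist u w + dist v w := dist_triangle_right u v w
  have ht : 0 ≤ dist v w := dist_nonneg
  have hK0 : 0 < K := by linarith
  have hL0 : 0 < L := by linarith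
  rw [div_le_iff₀ hK0] at hlow'
  rw [div_le_iff₀ (by positivity)]
  have hEL : (∑ j, p j * ρ j u v) * K ≤ (∑ j, p j * ρ j u v) * K * L :=
    le_mul_of_one_le_right (by positivity) hL
  have htL : dist v w ≤ dist v w * (K * L) :=
    le_mul_of_one_le_right ht (one_le_mul_of_one_le_of_one_le hK hL)
  have hEL0 : 0 ≤ (∑ j, p j * ρ j u v) * K * L := by positivity
  linarith

/-- Metric core of the **Multi-face embedding theorem**: mixing the `γ`
single-face random embeddings with the `γ` distance-to-face coordinate maps,
each chosen with probability `1/(2γ)`, yields a random embedding that is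
`L`-Lipschitz and, for every vertex `u` lying on one of the `γ` distinguished
faces and every vertex `v`, contracts the pair `(u,v)` in expectation by at
most a factor `8γKL`. -/
theorem multi_face_mixture
    {X : Type*} [MetricSpace X] [Fintype X]
    (γ : ℕ) (hγ : 1 ≤ γ)
    (A : Fin γ → Set X) (hA : ∀ i, (A i).Nonempty)
    (K L : ℝ) (hK : 1 ≤ K) (hL : 1 ≤ L)
    (m : Fin γ → ℕ)
    (ρ : ∀ i : Fin γ, Fin (m i) → X → X → ℝ)
    (p : ∀ i : Fin γ, Fin (m i) → ℝ)
    (hρ : ∀ i j, IsPseudometric (ρ i j))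
    (hp : ∀ i j, 0 ≤ p i j) (hpsum : ∀ i, ∑ j, p i j = 1)
    (hLip : ∀ i j, ∀ x y : X, ρ i j x y ≤ L * dist x y)
    (hlow : ∀ i, ∀ u ∈ A i, ∀ u' ∈ A i,
      dist u u' / K ≤ ∑ j, p i j * ρ i j u u')
    (τ : Fin γ → X → X → ℝ)
    (hτ : ∀ i (x y : X), τ i x y = |Metric.infDist x (A i) - Metric.infDist y (A i)|) :
    -- (a) the combined weights are nonnegative and sum to 1
    ((∀ i j, 0 ≤ p i j / (2 * γ)) ∧ (∀ i : Fin γ, (0:ℝ) ≤ 1 / (2 * γ)) ∧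
      (∑ i, ∑ j, p i j / (2 * γ)) + (∑ _i : Fin γ, 1 / (2 * (γ:ℝ))) = 1) ∧
    -- (b) every member of the combined family is bounded above by L·d
    ((∀ i j, ∀ x y : X, ρ i j x y ≤ L * dist x y) ∧
      (∀ i, ∀ x y : X, τ i x y ≤ L * dist x y)) ∧
    -- (c) the expectation at (u,v) is at least d(u,v)/(8γKL)
    (∀ u ∈ ⋃ i, A i, ∀ v : X,
      dist u v / (8 * γ * K * L) ≤
        (∑ i, ∑ j, p i j / (2 * γ) * ρ i j u v) +
        (∑ i, 1 / (2 * (γ:ℝ)) * τ i u v)) := by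
  have hγ0 : (0 : ℝ) < γ := by exact_mod_cast hγ
  refine ⟨⟨fun i j => div_nonneg (hp i j) (by positivity), fun _ => by positivity, ?_⟩,
    ⟨hLip, fun i x y => ?_⟩, fun u hu v => ?_⟩
  · simp only [← Finset.sum_div, hpsum, Finset.sum_const, Finset.card_univ, Fintype.card_fin,
      nsmul_eq_mul]
    field_simp
    norm_num
  · rw [hτ]
    exact (abs_infDist_sub_infDist_le_dist (A i) x y).trans
      (le_mul_of_one_le_left dist_nonneg hL)
  · obtain ⟨i, hi⟩ := Set.mem_iUnion.1 hu
    have hface := dist_div_le_expectation_add_infDist (Set.toFinite (A i)) hK hL (hρ i) (hp i)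
      (hpsum i) (hLip i) (hlow i) hi v
    have hτi : τ i u v = Metric.infDist v (A i) := by
      rw [hτ, Metric.infDist_zero_of_mem hi, zero_sub, abs_neg,
        abs_of_nonneg Metric.infDist_nonneg]
    have hρsum : ∑ j, p i j / (2 * γ) * ρ i j u v ≤
        ∑ i, ∑ j, p i j / (2 * γ) * ρ i j u v :=
      Finset.single_le_sum (f := fun i => ∑ j, p i j / (2 * γ) * ρ i j u v)
        (fun i _ => Finset.sum_nonneg fun j _ =>
          mul_nonneg (div_nonneg (hp i j) (by positivity)) ((hρ i j).1 u v))
        (Finset.mem_univ i)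
    have hτsum : 1 / (2 * (γ : ℝ)) * τ i u v ≤ ∑ i, 1 / (2 * (γ : ℝ)) * τ i u v :=
      Finset.single_le_sum (f := fun i => 1 / (2 * (γ : ℝ)) * τ i u v)
        (fun i _ => mul_nonneg (by positivity) (by rw [hτ]; exact abs_nonneg _))
        (Finset.mem_univ i)
    have hK0 : 0 < K := by linarith
    have hL0 : 0 < L := by linarith
    calc dist u v / (8 * γ * K * L) ≤ dist u v / (4 * γ * K * L) := by gcongr; norm_num
      _ = 1 / (2 * γ) * (dist u v / (2 * K * L)) := by field_simp; norm_num
      _ ≤ 1 / (2 * γ) * (∑ j, p i j * ρ i j u v + Metric.infDist v (A i)) := by gcongr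
      _ = ∑ j, p i j / (2 * γ) * ρ i j u v + 1 / (2 * (γ : ℝ)) * τ i u v := by
          rw [hτi, mul_add, Finset.mul_sum]
          congr 1
          exact Finset.sum_congr rfl fun j _ => by ring
      _ ≤ _ := add_le_add hρsum hτsum
end
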